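/- Let $R$ be a complete commutative noetherian local ring and $\Lambda$ a noetherian $R$-algebra. If $A$ is a finitely generated indecomposable non-projective Gorenstein projective $\Lambda$-module, then for every $i \ge 0$ the $i$-th syzygy $\Omega^i A$ (taken along minimal projective resolutions) is again indecomposable, non-projective, and Gorenstein projective. -/

import Mathlib

open LinearMap Function

/-- A bundled module over a ring `S`. -/
structure Mdl (S : Type) [Ring S] : Type 1 where
  carrier : Type
  [ag : AddCommGroup carrier]
  [mod : Module S carrier]

attribute [instance] Mdl.ag Mdl.mod

instance {S : Type} [Ring S] : CoeSort (Mdl S) Type := ⟨Mdl.carrier⟩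

/-- Bundle a module. -/
def Mdl.of (S : Type) [Ring S] (M : Type) [AddCommGroup M] [Module S M] : Mdl S := ⟨M⟩

section RingDefs

variable {S : Type} [Ring S]

/-- finitely generated projective -/
def FGProj (P : Mdl S) : Prop := Module.Projective S P.carrier ∧ Module.Finite S P.carrier

/-- superfluous (small) submodule -/
def Superfluous {P : Type} [AddCommGroup P] [Module S P] (K : Submodule S P) : Prop :=
  ∀ N : Submodule S P, N ⊔ K = ⊤ → N = ⊤

/-- projective cover of a module -/
def IsProjCover {P M : Mdl S} (p : P.carrier →ₗ[S] M.carrier) : Prop :=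
  FGProj P ∧ Function.Surjective p ∧ Superfluous (LinearMap.ker p)

/-- `N` is a (minimal) first syzygy of `M`. -/
def IsSyz1 (M N : Mdl S) : Prop :=
  ∃ (P : Mdl S) (p : P.carrier →ₗ[S] M.carrier),
    IsProjCover p ∧ Nonempty (N.carrier ≃ₗ[S] LinearMap.ker p)

/-- `N` is an `n`-th (minimal) syzygy of `M`. -/
def IsSyz (n : ℕ) (M N : Mdl S) : Prop :=
  ∃ F : Fin (n + 1) → Mdl S,
    Nonempty ((F 0).carrier ≃ₗ[S] M.carrier) ∧
    Nonempty ((F (Fin.last n)).carrier ≃ₗ[S] N.carrier) ∧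
    ∀ i : Fin n, IsSyz1 (F i.castSucc) (F i.succ)

/-- Gorenstein projective: a syzygy of a totally acyclic complex of
finitely generated projectives. -/
def IsGP (M : Mdl S) : Prop :=
  ∃ (P : ℤ → Mdl S) (d : ∀ i : ℤ, (P (i + 1)).carrier →ₗ[S] (P i).carrier),
    (∀ i, FGProj (P i)) ∧
    (∀ i, LinearMap.range (d (i + 1)) = LinearMap.ker (d i)) ∧
    (∀ (Q : Mdl S), Module.Projective S Q.carrier →
      ∀ (i : ℤ) (g : (P (i + 1)).carrier →ₗ[S] Q.carrier), g ∘ₗ d (i + 1) = 0 →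
        ∃ h : (P i).carrier →ₗ[S] Q.carrier, h ∘ₗ d i = g) ∧
    Nonempty (M.carrier ≃ₗ[S] LinearMap.ker (d 0))

/-- a map factoring through a projective module -/
def FactorsThruProj {A B : Mdl S} (φ : A.carrier →ₗ[S] B.carrier) : Prop :=
  ∃ (Q : Mdl S) (α : A.carrier →ₗ[S] Q.carrier) (β : Q.carrier →ₗ[S] B.carrier),
    Module.Projective S Q.carrier ∧ β ∘ₗ α = φ

/-- `M` is stable: it has no nonzero projective direct summand. -/
def NoProjSummand (M : Mdl S) : Prop :=
  ∀ N Q : Mdl S, Nonempty (M.carrier ≃ₗ[S] (N.carrier × Q.carrier)) →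
    Module.Projective S Q.carrier → Subsingleton Q.carrier

/-- indecomposable module -/
def IndecMod (M : Mdl S) : Prop :=
  Nontrivial M.carrier ∧
  ∀ N Q : Mdl S, Nonempty (M.carrier ≃ₗ[S] (N.carrier × Q.carrier)) →
    Subsingleton N.carrier ∨ Subsingleton Q.carrier

end RingDefs
section MorCat

variable {R : Type} [CommRing R]

/-- An object of the morphism category `𝓜`. -/
structure MObj (R : Type) [CommRing R] : Type 1 where
  dom : Mdl R
  cod : Mdl R
  map : dom.carrier →ₗ[R] cod.carrier

/-- A morphism in the morphism category: a commutative square. -/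
structure MHom (f g : MObj R) : Type where
  h1 : f.dom.carrier →ₗ[R] g.dom.carrier
  h2 : f.cod.carrier →ₗ[R] g.cod.carrier
  comm : g.map ∘ₗ h1 = h2 ∘ₗ f.map

/-- isomorphism in the morphism category -/
def MIso (f g : MObj R) : Prop :=
  ∃ (e1 : f.dom.carrier ≃ₗ[R] g.dom.carrier) (e2 : f.cod.carrier ≃ₗ[R] g.cod.carrier),
    g.map ∘ₗ (e1 : f.dom.carrier →ₗ[R] g.dom.carrier)
      = (e2 : f.cod.carrier →ₗ[R] g.cod.carrier) ∘ₗ f.map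

/-- epimorphism in the morphism category (componentwise surjective) -/
def MEpi {f g : MObj R} (φ : MHom f g) : Prop :=
  Function.Surjective φ.h1 ∧ Function.Surjective φ.h2

/-- projective object of the morphism category -/
def MProj (f : MObj R) : Prop :=
  ∀ (g h : MObj R) (e : MHom g h), MEpi e → ∀ φ : MHom f h,
    ∃ ψ : MHom f g, e.h1 ∘ₗ ψ.h1 = φ.h1 ∧ e.h2 ∘ₗ ψ.h2 = φ.h2

/-- projective cover in the morphism category: a right minimal epimorphism
from a projective object -/
def MProjCover {q f : MObj R} (φ : MHom q f) : Prop :=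
  MProj q ∧ MEpi φ ∧
  ∀ ξ : MHom q q, φ.h1 ∘ₗ ξ.h1 = φ.h1 → φ.h2 ∘ₗ ξ.h2 = φ.h2 →
    Function.Bijective ξ.h1 ∧ Function.Bijective ξ.h2

/-- `g` is a first syzygy of `f` in the morphism category. -/
def MSyz1 (f g : MObj R) : Prop :=
  ∃ (q : MObj R) (φ : MHom q f), MProjCover φ ∧
    ∃ k : (LinearMap.ker φ.h1 : Type) →ₗ[R] (LinearMap.ker φ.h2 : Type),
      (LinearMap.ker φ.h2).subtype ∘ₗ k = q.map ∘ₗ (LinearMap.ker φ.h1).subtype ∧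
      MIso g ⟨Mdl.of R (LinearMap.ker φ.h1), Mdl.of R (LinearMap.ker φ.h2), k⟩

/-- `g` is an `n`-th syzygy of `f` in the morphism category. -/
def MSyz (n : ℕ) (f g : MObj R) : Prop :=
  ∃ F : Fin (n + 1) → MObj R,
    MIso (F 0) f ∧ MIso (F (Fin.last n)) g ∧
    ∀ i : Fin n, MSyz1 (F i.castSucc) (F i.succ)

/-- `g` is the induced map on (minimal) first syzygies of the map `f`. -/
def MapSyz1 (f g : MObj R) : Prop :=
  ∃ (PA PB : Mdl R) (pA : PA.carrier →ₗ[R] f.dom.carrier)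
    (pB : PB.carrier →ₗ[R] f.cod.carrier) (L : PA.carrier →ₗ[R] PB.carrier),
    IsProjCover pA ∧ IsProjCover pB ∧ f.map ∘ₗ pA = pB ∘ₗ L ∧
    ∃ k : (LinearMap.ker pA : Type) →ₗ[R] (LinearMap.ker pB : Type),
      (LinearMap.ker pB).subtype ∘ₗ k = L ∘ₗ (LinearMap.ker pA).subtype ∧
      MIso g ⟨Mdl.of R (LinearMap.ker pA), Mdl.of R (LinearMap.ker pB), k⟩

/-- `g` is the induced map on minimal `n`-th syzygies of the map `f`. -/
def MapSyz (n : ℕ) (f g : MObj R) : Prop :=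
  ∃ F : Fin (n + 1) → MObj R,
    MIso (F 0) f ∧ MIso (F (Fin.last n)) g ∧
    ∀ i : Fin n, MapSyz1 (F i.castSucc) (F i.succ)

/-- direct sum in the morphism category -/
def DSum (f g : MObj R) : MObj R :=
  ⟨Mdl.of R (f.dom.carrier × g.dom.carrier), Mdl.of R (f.cod.carrier × g.cod.carrier),
    f.map.prodMap g.map⟩

/-- the zero object, up to iso -/
def MTrivial (f : MObj R) : Prop := Subsingleton f.dom.carrier ∧ Subsingleton f.cod.carrier

/-- indecomposable object of the morphism category -/
def MIndec (f : MObj R) : Prop :=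
  ¬ MTrivial f ∧ ∀ g h : MObj R, MIso f (DSum g h) → MTrivial g ∨ MTrivial h

/-- the endomorphism ring of `f` in the morphism category is local -/
def MEndLocal (f : MObj R) : Prop :=
  ¬ MTrivial f ∧
  ∀ ξ : MHom f f,
    (Function.Bijective ξ.h1 ∧ Function.Bijective ξ.h2) ∨
    (Function.Bijective ((LinearMap.id : f.dom.carrier →ₗ[R] f.dom.carrier) - ξ.h1) ∧
     Function.Bijective ((LinearMap.id : f.cod.carrier →ₗ[R] f.cod.carrier) - ξ.h2))

/-- no nonzero projective direct summand in the morphism category -/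
def MNoProjSummand (f : MObj R) : Prop :=
  ∀ g q : MObj R, MIso f (DSum g q) → MProj q → MTrivial q

/-- the cokernel module of an object -/
def CokMod (f : MObj R) : Mdl R := Mdl.of R (f.cod.carrier ⧸ LinearMap.range f.map)

/-- the cokernel object `Cok(f) : B → Cok f` -/
def CokObj (f : MObj R) : MObj R := ⟨f.cod, CokMod f, (LinearMap.range f.map).mkQ⟩

/-- Gorenstein projective objects of the morphism category -/
def InG (f : MObj R) : Prop :=
  Function.Injective f.map ∧ IsGP f.dom ∧ IsGP (CokMod f)

/-- objects of `𝓗`: morphisms between Gorenstein projective modules -/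
def InH (f : MObj R) : Prop := IsGP f.dom ∧ IsGP f.cod

/-- objects of `𝓔`: epimorphisms between Gorenstein projective modules -/
def InE (f : MObj R) : Prop := InH f ∧ Function.Surjective f.map

/-- `𝓖`-precover -/
def IsGPrecover {g x : MObj R} (φ : MHom g x) : Prop :=
  InG g ∧ ∀ g' : MObj R, InG g' → ∀ ψ : MHom g' x,
    ∃ ξ : MHom g' g, φ.h1 ∘ₗ ξ.h1 = ψ.h1 ∧ φ.h2 ∘ₗ ξ.h2 = ψ.h2

/-- right minimal morphism -/
def MRightMin {g x : MObj R} (φ : MHom g x) : Prop :=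
  ∀ ξ : MHom g g, φ.h1 ∘ₗ ξ.h1 = φ.h1 → φ.h2 ∘ₗ ξ.h2 = φ.h2 →
    Function.Bijective ξ.h1 ∧ Function.Bijective ξ.h2

/-- `𝓖`-cover -/
def IsGCover {g x : MObj R} (φ : MHom g x) : Prop := IsGPrecover φ ∧ MRightMin φ

/-- `𝓔`-preenvelope -/
def IsEPreenvelope {x e : MObj R} (φ : MHom x e) : Prop :=
  InE e ∧ ∀ e' : MObj R, InE e' → ∀ ψ : MHom x e',
    ∃ ξ : MHom e e', ξ.h1 ∘ₗ φ.h1 = ψ.h1 ∧ ξ.h2 ∘ₗ φ.h2 = ψ.h2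

/-- left minimal morphism -/
def MLeftMin {x e : MObj R} (φ : MHom x e) : Prop :=
  ∀ ξ : MHom e e, ξ.h1 ∘ₗ φ.h1 = φ.h1 → ξ.h2 ∘ₗ φ.h2 = φ.h2 →
    Function.Bijective ξ.h1 ∧ Function.Bijective ξ.h2

/-- `𝓔`-envelope -/
def IsEEnvelope {x e : MObj R} (φ : MHom x e) : Prop := IsEPreenvelope φ ∧ MLeftMin φ

/-- injective objects of `𝓗`: sums of `(P → P)` and `(P → 0)`,
i.e. objects isomorphic to a projection `P × P' → P`. -/
def HInj (q : MObj R) : Prop :=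
  ∃ P P' : Mdl R, FGProj P ∧ FGProj P' ∧
    MIso q ⟨Mdl.of R (P.carrier × P'.carrier), P, LinearMap.fst R P.carrier P'.carrier⟩

/-- no nonzero `𝓗`-injective direct summand -/
def MNoHInjSummand (f : MObj R) : Prop :=
  ∀ g q : MObj R, MIso f (DSum g q) → HInj q → MTrivial q

/-- `s` is (isomorphic to) the reduced `𝓖`-cover of `x` -/
def IsRedGCover (s x : MObj R) : Prop :=
  ∃ (g : MObj R) (φ : MHom g x), IsGCover φ ∧
    ∃ q : MObj R, MProj q ∧ MIso g (DSum s q) ∧ MNoProjSummand s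

/-- `s` is (isomorphic to) the reduced `𝓔`-envelope of `x` -/
def IsRedEEnvelope (s x : MObj R) : Prop :=
  ∃ (e : MObj R) (φ : MHom x e), IsEEnvelope φ ∧
    ∃ q : MObj R, HInj q ∧ MIso e (DSum s q) ∧ MNoHInjSummand s

/-- Auslander transpose of a module -/
def IsTranspose (M T : Mdl R) : Prop :=
  ∃ (P1 P0 : Mdl R) (d : P1.carrier →ₗ[R] P0.carrier) (p : P0.carrier →ₗ[R] M.carrier),
    FGProj P1 ∧ FGProj P0 ∧ Function.Surjective p ∧ Superfluous (LinearMap.ker p) ∧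
    LinearMap.range d = LinearMap.ker p ∧ Superfluous (LinearMap.ker d) ∧
    Nonempty (T.carrier ≃ₗ[R] (Module.Dual R P1.carrier ⧸ LinearMap.range d.dualMap))

/-- `L` is `λ M = Ω¹ Tr M`. -/
def LambdaOf (M L : Mdl R) : Prop := ∃ T : Mdl R, IsTranspose M T ∧ IsSyz1 T L

/-- horizontally linked module -/
def HorLinkedMod (M : Mdl R) : Prop :=
  ∃ L L2 : Mdl R, LambdaOf M L ∧ LambdaOf L L2 ∧ Nonempty (M.carrier ≃ₗ[R] L2.carrier)

/-- the Auslander transpose in the morphism category, computed by dualizing a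
(componentwise) minimal projective presentation
`(P₁ → P₁ ⊕ Q₁) → (P₀ → P₀ ⊕ Q₀) → f → 0` in `𝓜` against `𝐫 = (R → R ⊕ R)`. -/
def IsMTranspose (f t : MObj R) : Prop :=
  ∃ (P1 Q1 P0 Q0 : Mdl R)
    (u : P1.carrier →ₗ[R] P0.carrier)
    (v : (P1.carrier × Q1.carrier) →ₗ[R] (P0.carrier × Q0.carrier))
    (p : P0.carrier →ₗ[R] f.dom.carrier)
    (q : (P0.carrier × Q0.carrier) →ₗ[R] f.cod.carrier),
    FGProj P1 ∧ FGProj Q1 ∧ FGProj P0 ∧ FGProj Q0 ∧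
    v ∘ₗ LinearMap.inl R P1.carrier Q1.carrier = LinearMap.inl R P0.carrier Q0.carrier ∘ₗ u ∧
    q ∘ₗ LinearMap.inl R P0.carrier Q0.carrier = f.map ∘ₗ p ∧
    Function.Surjective p ∧ Function.Surjective q ∧
    Superfluous (LinearMap.ker p) ∧ Superfluous (LinearMap.ker q) ∧
    LinearMap.range u = LinearMap.ker p ∧ LinearMap.range v = LinearMap.ker q ∧
    Superfluous (LinearMap.ker u) ∧ Superfluous (LinearMap.ker v) ∧
    ∃ (e1 : t.dom.carrier ≃ₗ[R]
        (Module.Dual R Q1.carrier ⧸ LinearMap.range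
          (LinearMap.snd R P0.carrier Q0.carrier ∘ₗ v ∘ₗ
            LinearMap.inr R P1.carrier Q1.carrier).dualMap))
      (e2 : t.cod.carrier ≃ₗ[R]
        (Module.Dual R (P1.carrier × Q1.carrier) ⧸ LinearMap.range v.dualMap))
      (tt : (Module.Dual R Q1.carrier ⧸ LinearMap.range
          (LinearMap.snd R P0.carrier Q0.carrier ∘ₗ v ∘ₗ
            LinearMap.inr R P1.carrier Q1.carrier).dualMap) →ₗ[R]
        (Module.Dual R (P1.carrier × Q1.carrier) ⧸ LinearMap.range v.dualMap)),
      tt ∘ₗ (LinearMap.range (LinearMap.snd R P0.carrier Q0.carrier ∘ₗ v ∘ₗ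
          LinearMap.inr R P1.carrier Q1.carrier).dualMap).mkQ
        = (LinearMap.range v.dualMap).mkQ ∘ₗ (LinearMap.snd R P1.carrier Q1.carrier).dualMap ∧
      (e2 : t.cod.carrier →ₗ[R] _) ∘ₗ t.map = tt ∘ₗ (e1 : t.dom.carrier →ₗ[R] _)

/-- `g ≅ λ_𝓜 f = Ω¹_𝓜 Tr_𝓜 f` -/
def MLambda (f g : MObj R) : Prop := ∃ t : MObj R, IsMTranspose f t ∧ MSyz1 t g

/-- horizontally linked object of the submodule category -/
def MHorLinked (f : MObj R) : Prop :=
  ∃ g h : MObj R, MLambda f g ∧ MLambda g h ∧ MIso f h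

/-- the dual object `(B' → A')` of `(A → B)` -/
def DualObj (f : MObj R) : MObj R :=
  ⟨Mdl.of R (Module.Dual R f.cod.carrier), Mdl.of R (Module.Dual R f.dom.carrier), f.map.dualMap⟩

/-- componentwise short exact sequence in the morphism category -/
def MShortExact {a b c : MObj R} (φ : MHom a b) (ψ : MHom b c) : Prop :=
  Function.Injective φ.h1 ∧ Function.Injective φ.h2 ∧
  Function.Surjective ψ.h1 ∧ Function.Surjective ψ.h2 ∧
  LinearMap.range φ.h1 = LinearMap.ker ψ.h1 ∧
  LinearMap.range φ.h2 = LinearMap.ker ψ.h2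

/-- split monomorphism -/
def MSplitMono {a b : MObj R} (φ : MHom a b) : Prop :=
  ∃ σ : MHom b a, σ.h1 ∘ₗ φ.h1 = LinearMap.id ∧ σ.h2 ∘ₗ φ.h2 = LinearMap.id

/-- split epimorphism -/
def MSplitEpi {x c : MObj R} (θ : MHom x c) : Prop :=
  ∃ σ : MHom c x, θ.h1 ∘ₗ σ.h1 = LinearMap.id ∧ θ.h2 ∘ₗ σ.h2 = LinearMap.id

/-- almost split sequence in a full subcategory `C` of the morphism category -/
def IsAlmostSplitIn (C : MObj R → Prop) {a b c : MObj R}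
    (φ : MHom a b) (ψ : MHom b c) : Prop :=
  C a ∧ C b ∧ C c ∧ MShortExact φ ψ ∧ ¬ MSplitMono φ ∧ MEndLocal a ∧
  ∀ x : MObj R, C x → ∀ θ : MHom x c, ¬ MSplitEpi θ →
    ∃ ρ : MHom x b, ψ.h1 ∘ₗ ρ.h1 = θ.h1 ∧ ψ.h2 ∘ₗ ρ.h2 = θ.h2

end MorCat

/-- A Gorenstein local ring: noetherian local, and some fixed syzygy functor lands in
Gorenstein projective (maximal Cohen-Macaulay) modules. -/
def IsGorensteinLocal (R : Type) [CommRing R] : Prop :=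
  IsNoetherianRing R ∧ IsLocalRing R ∧
  ∃ n : ℕ, ∀ M : Mdl R, Module.Finite R M.carrier → ∀ N : Mdl R, IsSyz n M N → IsGP N


/-- A finite module over a complete noetherian local ring is complete. -/
theorem isAdicComplete_of_module_finite {R : Type*} [CommRing R] [IsNoetherianRing R]
    [IsLocalRing R] [IsAdicComplete (IsLocalRing.maximalIdeal R) R]
    (M : Type*) [AddCommGroup M] [Module R M] [Module.Finite R M] :
    IsAdicComplete (IsLocalRing.maximalIdeal R) M := by
  set I := IsLocalRing.maximalIdeal R
  have hpre : IsPrecomplete I M := by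
    rw [← AdicCompletion.of_surjective_iff]
    intro x
    obtain ⟨t, rfl⟩ := AdicCompletion.ofTensorProduct_surjective_of_finite I M x
    induction t using TensorProduct.induction_on with
    | zero => exact ⟨0, by simp⟩
    | tmul r m =>
      obtain ⟨r, rfl⟩ := AdicCompletion.of_surjective I R r
      refine ⟨r • m, ?_⟩
      rw [AdicCompletion.ofTensorProduct_tmul]
      ext n
      simp only [map_smul, AdicCompletion.smul_eval, AdicCompletion.of_apply]
      rfl
    | add t₁ t₂ h₁ h₂ =>
      obtain ⟨y₁, h₁⟩ := h₁
      obtain ⟨y₂, h₂⟩ := h₂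
      exact ⟨y₁ + y₂, by rw [map_add, map_add, h₁, h₂]⟩
  exact { toIsPrecomplete := hpre }

/-- Idempotents lift along an ideal satisfying Hensel's lemma. -/
theorem HenselianRing.exists_isIdempotentElem_lift {S : Type*} [CommRing S] (J : Ideal S)
    [HenselianRing S J] {b : S ⧸ J} (hb : IsIdempotentElem b) :
    ∃ e : S, IsIdempotentElem e ∧ Ideal.Quotient.mk J e = b := by
  nontriviality S
  obtain ⟨a, rfl⟩ := Ideal.Quotient.mk_surjective b
  have hb' : Ideal.Quotient.mk J a * Ideal.Quotient.mk J a = Ideal.Quotient.mk J a := hb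
  obtain ⟨e, he, hea⟩ := HenselianRing.is_henselian (I := J)
    (Polynomial.X ^ 2 - Polynomial.X : Polynomial S)
    (Polynomial.monic_X_pow_sub (by simp)) a
    (by
      rw [← Ideal.Quotient.eq_zero_iff_mem]
      simp [pow_two, hb'])
    (by
      refine IsUnit.of_mul_eq_one
        (Ideal.Quotient.mk J (2 * a - 1)) ?_
      have hder : (Polynomial.X ^ 2 - Polynomial.X : Polynomial S).derivative.eval a
          = 2 * a - 1 := by simp [one_add_one_eq_two]
      rw [hder, ← map_mul, ← map_one (Ideal.Quotient.mk J), Ideal.Quotient.eq]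
      have hmem := Ideal.mul_mem_left J 4 (Ideal.Quotient.eq.1 ((map_mul _ a a).trans hb'))
      convert hmem using 1
      ring)
  refine ⟨e, ?_, Ideal.Quotient.eq.2 hea⟩
  have : e ^ 2 - e = 0 := by simpa using! he
  simpa [IsIdempotentElem, pow_two, sub_eq_zero] using this

/-- Fitting decomposition of an element of a commutative artinian ring. -/
theorem IsArtinianRing.exists_isIdempotentElem_isUnit {S : Type*} [CommRing S]
    [IsArtinianRing S] (s : S) :
    ∃ e : S, IsIdempotentElem e ∧ IsUnit (s * e + (1 - e)) ∧ IsUnit ((1 - s) * (1 - e) + e) := by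
  obtain ⟨n, y, hy⟩ := IsArtinian.exists_pow_succ_smul_dvd s (1 : S)
  simp only [smul_eq_mul, mul_one] at hy
  have key : ∀ k, s ^ (n + k) * y ^ k = s ^ n := by
    intro k
    induction k with
    | zero => simp
    | succ k ih =>
      calc s ^ (n + (k + 1)) * y ^ (k + 1) = (s ^ (n + 1) * y) * (s ^ k * y ^ k) := by ring
        _ = s ^ (n + k) * y ^ k := by rw [hy]; ring
        _ = s ^ n := ih
  have he : s ^ n * y ^ n * (s ^ n * y ^ n) = s ^ n * y ^ n := by
    calc _ = (s ^ (n + n) * y ^ n) * y ^ n := by ring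
      _ = _ := by rw [key]
  have hsy : s * y * (s ^ n * y ^ n) = s ^ n * y ^ n := by
    calc _ = (s ^ (n + 1) * y) * y ^ n := by ring
      _ = _ := by rw [hy]
  have hnil : s ^ n * (1 - s ^ n * y ^ n) = 0 := by
    have := key n
    linear_combination -this
  generalize s ^ n * y ^ n = e at he hsy hnil
  refine ⟨e, he, IsUnit.of_mul_eq_one (y * e + (1 - e)) ?_, ?_⟩
  · linear_combination (s * y - s - y + 1) * he + hsy
  · have : IsNilpotent (s * (1 - e)) :=
      ⟨n + 1, by rw [mul_pow]; linear_combination (s * (1 - e) ^ n) * hnil⟩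
    convert this.isUnit_one_sub using 1
    ring

/-- Fitting decomposition of an element of a finite commutative algebra over a complete noetherian
local ring. -/
theorem exists_isIdempotentElem_isUnit_of_finite (R : Type*) [CommRing R] [IsNoetherianRing R]
    [IsLocalRing R] [IsAdicComplete (IsLocalRing.maximalIdeal R) R]
    {S : Type*} [CommRing S] [Algebra R S] [Module.Finite R S] (s : S) :
    ∃ e : S, IsIdempotentElem e ∧ IsUnit (s * e + (1 - e)) ∧ IsUnit ((1 - s) * (1 - e) + e) := by
  set m := IsLocalRing.maximalIdeal R
  let J := m.map (algebraMap R S)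
  have : IsAdicComplete m S := isAdicComplete_of_module_finite S
  have : IsAdicComplete J S := (IsAdicComplete.map_algebraMap_iff m S).2 this
  have : IsArtinianRing (R ⧸ m) :=
    letI := Ideal.Quotient.field m
    inferInstance
  have : Module.Finite R (S ⧸ J) :=
    Module.Finite.of_surjective ((Ideal.Quotient.mkₐ R J).toLinearMap)
      (Ideal.Quotient.mkₐ_surjective R J)
  have : Module.Finite (R ⧸ m) (S ⧸ J) := Module.Finite.of_restrictScalars_finite R _ _
  have : IsArtinianRing (S ⧸ J) := IsArtinianRing.of_finite (R ⧸ m) (S ⧸ J)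
  obtain ⟨b, hb, hb₁, hb₂⟩ :=
    IsArtinianRing.exists_isIdempotentElem_isUnit (Ideal.Quotient.mk J s)
  obtain ⟨e, he, rfl⟩ := HenselianRing.exists_isIdempotentElem_lift J hb
  have := isLocalHom_of_le_jacobson_bot J (IsAdicComplete.le_jacobson_bot J)
  exact ⟨e, he, isUnit_of_map_unit (Ideal.Quotient.mk J) _ (by simpa using hb₁),
    isUnit_of_map_unit (Ideal.Quotient.mk J) _ (by simpa using hb₂)⟩

/-- In a finite algebra over a complete noetherian local ring, one of `a` and `1 - a` is a unit
as soon as there are no nontrivial idempotents. -/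
theorem isUnit_or_isUnit_one_sub_of_forall_isIdempotentElem (R : Type*) [CommRing R]
    [IsNoetherianRing R] [IsLocalRing R] [IsAdicComplete (IsLocalRing.maximalIdeal R) R]
    {E : Type*} [Ring E] [Algebra R E] [Module.Finite R E]
    (hE : ∀ e : E, IsIdempotentElem e → e = 0 ∨ e = 1) (a : E) :
    IsUnit a ∨ IsUnit (1 - a) := by
  let S := Algebra.adjoin R {a}
  have : IsMulCommutative S := Algebra.isMulCommutative_adjoin R (by simp)
  have : IsNoetherian R E := isNoetherian_of_isNoetherianRing_of_finite R E
  have : Module.Finite R S :=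
    inferInstanceAs (Module.Finite R (Subalgebra.toSubmodule S))
  obtain ⟨e, he, h₁, h₂⟩ := exists_isIdempotentElem_isUnit_of_finite R
    (⟨a, Algebra.subset_adjoin rfl⟩ : S)
  have h₁ := h₁.map S.val
  have h₂ := h₂.map S.val
  have he : IsIdempotentElem (S.val e) := he.map S.val
  simp only [map_add, map_mul, map_sub, map_one] at h₁ h₂
  rcases hE _ he with h | h
  · rw [h] at h₂
    exact .inr (by simpa using h₂)
  · rw [h] at h₁
    exact .inl (by simpa using h₁)

/-- A finitely generated module over a finite algebra over a complete noetherian local ring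
has a local endomorphism ring if it is indecomposable. -/
theorem IndecMod.isUnit_or_isUnit_one_sub (R : Type) [CommRing R] [IsNoetherianRing R]
    [IsLocalRing R] [IsAdicComplete (IsLocalRing.maximalIdeal R) R]
    {S : Type} [Ring S] [Algebra R S] [Module.Finite R S] {A : Mdl S}
    [Module.Finite S A.carrier] (hA : IndecMod A) (a : Module.End S A.carrier) :
    IsUnit a ∨ IsUnit (1 - a) := by
  let : Module R A.carrier := Module.compHom A.carrier (algebraMap R S)
  have : IsScalarTower R S A.carrier := IsScalarTower.of_algebraMap_smul fun _ _ => rfl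
  have : Module.Finite R A.carrier := Module.Finite.trans S A.carrier
  have : Module.Finite R (Module.End S A.carrier) :=
    Module.Finite.of_injective (LinearMap.restrictScalarsₗ R S A.carrier A.carrier R)
      (LinearMap.restrictScalars_injective R)
  refine isUnit_or_isUnit_one_sub_of_forall_isIdempotentElem R (fun e he => ?_) a
  have hcompl : IsCompl (LinearMap.range e) (LinearMap.ker e) :=
    (LinearMap.IsIdempotentElem.isCompl he)
  rcases hA.2 (Mdl.of S (LinearMap.range e)) (Mdl.of S (LinearMap.ker e))
    ⟨(Submodule.prodEquivOfIsCompl _ _ hcompl).symm⟩ with h | h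
  · left
    exact LinearMap.range_eq_bot.1 ((Submodule.subsingleton_iff_eq_bot).1 h)
  · right
    have hinj : Function.Injective e :=
      LinearMap.ker_eq_bot.1 ((Submodule.subsingleton_iff_eq_bot).1 h)
    ext x
    exact hinj (LinearMap.congr_fun he x)

section Syzygies

variable {S : Type} [Ring S]

theorem IndecMod.of_forall_isIdempotentElem {N : Mdl S} [Nontrivial N.carrier]
    (hN : ∀ e : Module.End S N.carrier, IsIdempotentElem e → e = 0 ∨ e = 1) : IndecMod N := by
  refine ⟨inferInstance, fun X Y ⟨φ⟩ => ?_⟩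
  let e : Module.End S N.carrier := φ.symm.toLinearMap ∘ₗ LinearMap.inl S X.carrier Y.carrier ∘ₗ
    LinearMap.fst S X.carrier Y.carrier ∘ₗ φ.toLinearMap
  have he : ∀ z, e (φ.symm z) = φ.symm (z.1, 0) := fun z => by simp [e]
  have hidem : IsIdempotentElem e := by
    ext x
    simp [e]
  rcases hN e hidem with h | h
  · left
    refine subsingleton_of_forall_eq 0 fun x => ?_
    simpa [h] using (he (x, 0)).symm
  · right
    refine subsingleton_of_forall_eq 0 fun y => ?_
    simpa [h] using he (0, y)

theorem IndecMod.congr {M N : Mdl S} (e : M.carrier ≃ₗ[S] N.carrier) (hM : IndecMod M) :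
    IndecMod N := by
  have := hM.1
  exact ⟨e.injective.nontrivial, fun X Y ⟨φ⟩ => hM.2 X Y ⟨e.trans φ⟩⟩

theorem IsGP.congr {M N : Mdl S} (e : M.carrier ≃ₗ[S] N.carrier) (hM : IsGP M) : IsGP N := by
  obtain ⟨P, d, h₁, h₂, h₃, ⟨φ⟩⟩ := hM
  exact ⟨P, d, h₁, h₂, h₃, ⟨e.symm.trans φ⟩⟩

theorem LinearMap.exists_comp_eq_of_ker_le {X Y Z : Type*} [AddCommGroup X] [AddCommGroup Y]
    [AddCommGroup Z] [Module S X] [Module S Y] [Module S Z] {f : X →ₗ[S] Y}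
    (hf : Function.Surjective f) (g : X →ₗ[S] Z) (h : LinearMap.ker f ≤ LinearMap.ker g) :
    ∃ k : Y →ₗ[S] Z, k ∘ₗ f = g := by
  refine ⟨(LinearMap.ker f).liftQ g h ∘ₗ (f.quotKerEquivOfSurjective hf).symm, ?_⟩
  ext x
  have : (f.quotKerEquivOfSurjective hf).symm (f x) = (LinearMap.ker f).mkQ x := by
    rw [LinearEquiv.symm_apply_eq]
    rfl
  simp [this]

/-- The kernel of a surjection between projective modules is projective. -/
theorem Module.Projective.ker_of_surjective {P Q : Type*} [AddCommGroup P] [AddCommGroup Q]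
    [Module S P] [Module S Q] [Module.Projective S P] [Module.Projective S Q]
    {f : P →ₗ[S] Q} (hf : Function.Surjective f) : Module.Projective S (LinearMap.ker f) ∧
      ∃ r : P →ₗ[S] LinearMap.ker f, Function.Surjective r := by
  obtain ⟨s, hs⟩ := Module.projective_lifting_property f LinearMap.id hf
  have hs' : ∀ y, f (s y) = y := LinearMap.congr_fun hs
  let r : P →ₗ[S] LinearMap.ker f :=
    (LinearMap.id - s ∘ₗ f).codRestrict _ fun x => by simp [hs']
  have hr : r ∘ₗ (LinearMap.ker f).subtype = LinearMap.id := by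
    ext x
    simp [r]
  exact ⟨Module.Projective.of_split _ r hr, r, fun x => ⟨x, LinearMap.congr_fun hr x⟩⟩

/-- `Z` is a kernel of a map from a finitely generated projective module onto `Y`, and maps
from `Z` to projective modules extend along the inclusion. -/
def IsAcyclicSyz (Y Z : Mdl S) : Prop :=
  ∃ (P : Mdl S) (p : P.carrier →ₗ[S] Y.carrier) (j : Z.carrier →ₗ[S] P.carrier),
    FGProj P ∧ Function.Surjective p ∧ Function.Injective j ∧
    LinearMap.range j = LinearMap.ker p ∧
    ∀ Q : Mdl S, Module.Projective S Q.carrier → ∀ g : Z.carrier →ₗ[S] Q.carrier,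
      ∃ h : P.carrier →ₗ[S] Q.carrier, h ∘ₗ j = g

theorem IsAcyclicSyz.mk {Y Z : Mdl S} {P : Type} [AddCommGroup P] [Module S P]
    [Module.Projective S P] [Module.Finite S P] (p : P →ₗ[S] Y.carrier) (j : Z.carrier →ₗ[S] P)
    (hp : Function.Surjective p) (hj : Function.Injective j)
    (hpj : LinearMap.range j = LinearMap.ker p)
    (h : ∀ Q : Mdl S, Module.Projective S Q.carrier → ∀ g : Z.carrier →ₗ[S] Q.carrier,
      ∃ h : P →ₗ[S] Q.carrier, h ∘ₗ j = g) : IsAcyclicSyz Y Z :=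
  ⟨Mdl.of S P, p, j, ⟨inferInstanceAs (Module.Projective S P),
    inferInstanceAs (Module.Finite S P)⟩, hp, hj, hpj, h⟩

theorem IsGP.exists_seq {M : Mdl S} (hM : IsGP M) :
    ∃ X : ℤ → Mdl S, Nonempty (M.carrier ≃ₗ[S] (X 0).carrier) ∧
      ∀ i, IsAcyclicSyz (X i) (X (i + 1)) := by
  obtain ⟨P, d, hP, hd, hQ, hM⟩ := hM
  refine ⟨fun i => Mdl.of S (LinearMap.ker (d i)), hM, fun i => ?_⟩
  have hmem : ∀ x, d (i + 1) x ∈ LinearMap.ker (d i) := fun x =>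
    hd i ▸ LinearMap.mem_range_self _ x
  refine ⟨P (i + 1 + 1), (d (i + 1)).codRestrict _ hmem, (LinearMap.ker (d (i + 1))).subtype,
    hP _, ?_, Subtype.val_injective, ?_, fun Q hproj g => ?_⟩
  · rintro ⟨x, hx⟩
    rw [← hd i] at hx
    obtain ⟨y, rfl⟩ := hx
    exact ⟨y, rfl⟩
  · exact (Submodule.range_subtype _).trans (LinearMap.ker_codRestrict _ _ hmem).symm
  · have hmem' : ∀ x, d (i + 1 + 1) x ∈ LinearMap.ker (d (i + 1)) := fun x =>
      hd (i + 1) ▸ LinearMap.mem_range_self _ x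
    obtain ⟨h, hh⟩ := hQ Q hproj (i + 1 + 1) (g ∘ₗ (d (i + 1 + 1)).codRestrict _ hmem') (by
      ext x
      have : d (i + 1 + 1) (d (i + 1 + 1 + 1) x) = 0 :=
        LinearMap.mem_ker.1 (hd (i + 1 + 1) ▸ LinearMap.mem_range_self _ x)
      have : (d (i + 1 + 1)).codRestrict _ hmem' (d (i + 1 + 1 + 1) x) = 0 := Subtype.ext this
      exact (congrArg g this).trans (map_zero g))
    refine ⟨h, ?_⟩
    refine LinearMap.ext fun ⟨x, hx⟩ => ?_
    have hx' : x ∈ LinearMap.range (d (i + 1 + 1)) := hd (i + 1) ▸ hx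
    obtain ⟨y, rfl⟩ := hx'
    exact LinearMap.congr_fun hh y

theorem IsGP.of_seq {M : Mdl S} {X : ℤ → Mdl S} {k : ℤ}
    (hX : ∀ i, IsAcyclicSyz (X i) (X (i + 1))) (e : M.carrier ≃ₗ[S] (X k).carrier) :
    IsGP M := by
  wlog hk : k = 0 + 1 + 1 generalizing X k
  · refine this (X := fun i => X (i + (k - 2))) (k := 0 + 1 + 1) (fun i => ?_) ?_ rfl
    · have := hX (i + (k - 2))
      rwa [add_right_comm] at this
    · have : 0 + 1 + 1 + (k - 2) = k := by ring
      rw [this]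
      exact e
  subst hk
  choose P p j hP hp hj hpj hQ using hX
  refine ⟨P, fun i => j i ∘ₗ p (i + 1), hP, fun i => ?_, fun Q hproj i g hg => ?_, ⟨?_⟩⟩
  · rw [LinearMap.range_comp_of_range_eq_top _ (LinearMap.range_eq_top.2 (hp _)), hpj,
      LinearMap.ker_comp_of_ker_eq_bot _ (LinearMap.ker_eq_bot.2 (hj _))]
  · obtain ⟨g', hg'⟩ := LinearMap.exists_comp_eq_of_ker_le (hp (i + 1)) g (by
      rw [← hpj]
      rintro _ ⟨z, rfl⟩
      obtain ⟨y, rfl⟩ := hp _ z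
      exact LinearMap.congr_fun hg y)
    obtain ⟨h, hh⟩ := hQ i Q hproj g'
    exact ⟨h, by rw [← LinearMap.comp_assoc, hh, hg']⟩
  · rw [LinearMap.ker_comp_of_ker_eq_bot _ (LinearMap.ker_eq_bot.2 (hj _)), ← hpj]
    exact e.trans (LinearEquiv.ofInjective _ (hj _))

/-- The vanishing of `Ext¹(Y, Q)` for projective `Q` does not depend on the presentation. -/
theorem IsAcyclicSyz.exists_extension {Y Z : Mdl S} (h : IsAcyclicSyz Y Z) {P : Mdl S}
    {p : P.carrier →ₗ[S] Y.carrier} (hp : Function.Surjective p) {Q : Mdl S}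
    (hQ : Module.Projective S Q.carrier) (g : LinearMap.ker p →ₗ[S] Q.carrier) :
    ∃ k : P.carrier →ₗ[S] Q.carrier, k ∘ₗ (LinearMap.ker p).subtype = g := by
  obtain ⟨P₁, p₁, j₁, hP₁, hp₁, hj₁, hpj₁, hQ₁⟩ := h
  have := hP₁.1
  obtain ⟨u, hu⟩ := Module.projective_lifting_property p p₁ hp
  have hu' : ∀ x, p (u x) = p₁ x := LinearMap.congr_fun hu
  have hpj₁' : ∀ z, p₁ (j₁ z) = 0 := fun z =>
    LinearMap.mem_ker.1 (hpj₁ ▸ LinearMap.mem_range_self j₁ z)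
  let w : Z.carrier →ₗ[S] LinearMap.ker p :=
    (u ∘ₗ j₁).codRestrict _ fun z => by simp [hu', hpj₁']
  obtain ⟨h, hh⟩ := hQ₁ Q hQ (g ∘ₗ w)
  obtain ⟨k, hk⟩ := LinearMap.exists_comp_eq_of_ker_le
    (f := u.coprod (LinearMap.ker p).subtype) (fun x => by
      obtain ⟨y, hy⟩ := hp₁ (p x)
      exact ⟨(y, ⟨x - u y, by simp [hu', hy]⟩), by simp⟩) (h.coprod g) (by
      rintro ⟨x, n⟩ hxn
      have hxn : u x + n = 0 := by simpa using hxn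
      have hx : x ∈ LinearMap.ker p₁ := by
        rw [LinearMap.mem_ker, ← hu', eq_neg_of_add_eq_zero_left hxn, map_neg,
          LinearMap.mem_ker.1 n.2, neg_zero]
      rw [← hpj₁] at hx
      obtain ⟨z, rfl⟩ := hx
      have hn : n = -w z := Subtype.ext (eq_neg_of_add_eq_zero_right hxn)
      have := LinearMap.congr_fun hh z
      simp only [LinearMap.comp_apply] at this
      simp [this, hn])
  refine ⟨k, ?_⟩
  ext n
  simpa using LinearMap.congr_fun hk (0, n)

/-- In an acyclic resolution, a syzygy may be replaced by the minimal one. -/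
theorem IsAcyclicSyz.replace {Y Z W N P : Mdl S} (hYZ : IsAcyclicSyz Y Z)
    (hZW : IsAcyclicSyz Z W) {p : P.carrier →ₗ[S] Y.carrier} (hp : IsProjCover p)
    (e : N.carrier ≃ₗ[S] LinearMap.ker p) : IsAcyclicSyz Y N ∧ IsAcyclicSyz N W := by
  obtain ⟨hP, hps, hsup⟩ := hp
  constructor
  · refine ⟨P, p, (LinearMap.ker p).subtype ∘ₗ e.toLinearMap, hP, hps,
      Subtype.val_injective.comp e.injective, ?_, fun Q hQ g => ?_⟩
    · rw [LinearMap.range_comp_of_range_eq_top _ e.range]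
      exact Submodule.range_subtype _
    · obtain ⟨k, hk⟩ := hYZ.exists_extension hps hQ (g ∘ₗ e.symm.toLinearMap)
      refine ⟨k, ?_⟩
      rw [← LinearMap.comp_assoc, hk]
      ext
      simp
  obtain ⟨P₁, p₁, j₁, hP₁, hp₁, hj₁, hpj₁, -⟩ := hYZ
  obtain ⟨P₂, p₂, j₂, hP₂, hp₂, hj₂, hpj₂, hQ₂⟩ := hZW
  have := hP₁.1
  have := hP.1
  obtain ⟨u, hu⟩ := Module.projective_lifting_property p p₁ hps
  have hu' : ∀ x, p (u x) = p₁ x := LinearMap.congr_fun hu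
  have hus : Function.Surjective u := by
    refine LinearMap.range_eq_top.1 (hsup _ (eq_top_iff.2 fun x _ => ?_))
    obtain ⟨y, hy⟩ := hp₁ (p x)
    exact Submodule.mem_sup.2 ⟨u y, ⟨y, rfl⟩, x - u y, by simp [hu', hy], by simp⟩
  obtain ⟨v, hv⟩ := Module.projective_lifting_property u LinearMap.id hus
  have hv' : ∀ x, u (v x) = x := LinearMap.congr_fun hv
  have hpj₁' : ∀ z, p₁ (j₁ z) = 0 := fun z =>
    LinearMap.mem_ker.1 (hpj₁ ▸ LinearMap.mem_range_self j₁ z)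
  have hpj₂' : ∀ z, p₂ (j₂ z) = 0 := fun z =>
    LinearMap.mem_ker.1 (hpj₂ ▸ LinearMap.mem_range_self j₂ z)
  have hlift : ∀ y, p₁ y = 0 → ∃ x, j₁ (p₂ x) = y := by
    intro y hy
    have hy : y ∈ LinearMap.range j₁ := hpj₁ ▸ hy
    obtain ⟨z, rfl⟩ := hy
    obtain ⟨x, rfl⟩ := hp₂ z
    exact ⟨x, rfl⟩
  let ρ : P₂.carrier →ₗ[S] LinearMap.ker u :=
    ((LinearMap.id - v ∘ₗ u) ∘ₗ j₁ ∘ₗ p₂).codRestrict _ fun x => by simp [hv']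
  have hρ : ∀ x, (ρ x : P₁.carrier) = j₁ (p₂ x) - v (u (j₁ (p₂ x))) := fun _ => rfl
  have hρs : Function.Surjective ρ := by
    rintro ⟨y, hy⟩
    have hy : u y = 0 := hy
    obtain ⟨x, rfl⟩ := hlift y (by rw [← hu', hy, map_zero])
    exact ⟨x, Subtype.ext (by rw [hρ, hy, map_zero, sub_zero])⟩
  let q : LinearMap.ker ρ →ₗ[S] LinearMap.ker p :=
    (u ∘ₗ j₁ ∘ₗ p₂ ∘ₗ (LinearMap.ker ρ).subtype).codRestrict _ fun x => by simp [hu', hpj₁']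
  have hq : ∀ x, (q x : P.carrier) = u (j₁ (p₂ x)) := fun _ => rfl
  let j : W.carrier →ₗ[S] LinearMap.ker ρ :=
    j₂.codRestrict _ fun w => Subtype.ext (by rw [hρ]; simp [hpj₂'])
  have := hP₂.1
  have := hP₂.2
  have := (Module.Projective.ker_of_surjective hus).1
  obtain ⟨_, r, hr⟩ := Module.Projective.ker_of_surjective hρs
  have := Module.Finite.of_surjective r hr
  refine .mk (e.symm.toLinearMap ∘ₗ q) j (e.symm.surjective.comp ?_)
    (fun a b hab => hj₂ (congrArg Subtype.val hab)) ?_ fun Q hQ g => ?_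
  · rintro ⟨n, hn⟩
    have hn : p n = 0 := hn
    obtain ⟨x, hx⟩ := hlift (v n) (by rw [← hu', hv', hn])
    exact ⟨⟨x, Subtype.ext (by rw [hρ, hx, hv']; simp)⟩,
      Subtype.ext (by rw [hq]; simp only [hx, hv'])⟩
  · rw [LinearMap.ker_comp_of_ker_eq_bot _ e.symm.ker]
    apply le_antisymm
    · rintro _ ⟨w, rfl⟩
      refine Subtype.ext ?_
      rw [hq]
      change u (j₁ (p₂ (j₂ w))) = 0
      simp [hpj₂']
    · rintro ⟨x, hx⟩ hxq
      have hxq : u (j₁ (p₂ x)) = 0 := congrArg Subtype.val (LinearMap.mem_ker.1 hxq)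
      have hx' : j₁ (p₂ x) - v (u (j₁ (p₂ x))) = 0 := congrArg Subtype.val hx
      rw [hxq, map_zero, sub_zero] at hx'
      have hx' : x ∈ LinearMap.range j₂ := hpj₂ ▸ hj₁ (hx'.trans (map_zero j₁).symm)
      obtain ⟨w, rfl⟩ := hx'
      exact ⟨w, rfl⟩
  · obtain ⟨h, hh⟩ := hQ₂ Q hQ g
    exact ⟨h ∘ₗ (LinearMap.ker ρ).subtype, hh⟩

/-- Minimal syzygies of Gorenstein projective modules are Gorenstein projective. -/
theorem IsGP.of_isSyz1 {M N : Mdl S} (hM : IsGP M) (h : IsSyz1 M N) : IsGP N := by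
  obtain ⟨X, ⟨φ⟩, hX⟩ := hM.exists_seq
  obtain ⟨P, p, ⟨hP, hps, hsup⟩, ⟨e⟩⟩ := h
  have hker : LinearMap.ker (φ.toLinearMap ∘ₗ p) = LinearMap.ker p :=
    LinearMap.ker_comp_of_ker_eq_bot _ φ.ker
  obtain ⟨h₀, h₁⟩ := (hX 0).replace (hX (0 + 1)) (N := N) (p := φ.toLinearMap ∘ₗ p)
    ⟨hP, φ.surjective.comp hps, hker.symm ▸ hsup⟩ (e.trans (LinearEquiv.ofEq _ _ hker.symm))
  refine IsGP.of_seq (X := Function.update X 1 N) (k := 1) (fun i => ?_)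
    (by rw [Function.update_self])
  rcases eq_or_ne i 0 with rfl | hi
  · simpa using h₀
  rcases eq_or_ne i 1 with rfl | hi'
  · simpa [Function.update_of_ne] using h₁
  · rw [Function.update_of_ne hi', Function.update_of_ne (by omega)]
    exact hX i

/-- Maps from a syzygy of a Gorenstein projective module to projective modules extend. -/
theorem IsGP.exists_extension {M P : Mdl S} (hM : IsGP M) {p : P.carrier →ₗ[S] M.carrier}
    (hp : Function.Surjective p) {Q : Type} [AddCommGroup Q] [Module S Q]
    [hQ : Module.Projective S Q] (g : LinearMap.ker p →ₗ[S] Q) :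
    ∃ k : P.carrier →ₗ[S] Q, k ∘ₗ (LinearMap.ker p).subtype = g := by
  obtain ⟨X, ⟨φ⟩, hX⟩ := hM.exists_seq
  have hker : LinearMap.ker (φ.toLinearMap ∘ₗ p) = LinearMap.ker p :=
    LinearMap.ker_comp_of_ker_eq_bot _ φ.ker
  obtain ⟨k, hk⟩ := (hX 0).exists_extension (p := φ.toLinearMap ∘ₗ p) (φ.surjective.comp hp)
    (Q := Mdl.of S Q) hQ
    (g ∘ₗ (LinearEquiv.ofEq _ _ hker).toLinearMap)
  refine ⟨k, ?_⟩
  ext x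
  exact LinearMap.congr_fun hk ((LinearEquiv.ofEq _ _ hker).symm x)

/-- A Gorenstein projective module with a projective syzygy is projective. -/
theorem IsGP.projective_of_ker {M P : Mdl S} (hM : IsGP M) (hP : Module.Projective S P.carrier)
    {p : P.carrier →ₗ[S] M.carrier} (hp : Function.Surjective p)
    (hker : Module.Projective S (LinearMap.ker p)) : Module.Projective S M.carrier := by
  obtain ⟨r, hr⟩ := hM.exists_extension hp (LinearMap.id : LinearMap.ker p →ₗ[S] _)
  obtain ⟨s, hs⟩ := LinearMap.exists_comp_eq_of_ker_le hp
    (LinearMap.id - (LinearMap.ker p).subtype ∘ₗ r) (fun x hx => by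
      have : r x = ⟨x, hx⟩ := LinearMap.congr_fun hr ⟨x, hx⟩
      simp [this])
  refine Module.Projective.of_split s p ?_
  ext y
  obtain ⟨x, rfl⟩ := hp y
  have hsx : s (p x) = x - r x := LinearMap.congr_fun hs x
  have : p (r x) = 0 := LinearMap.mem_ker.1 (r x).2
  simp [hsx, this]

/-- An endomorphism of a projective cover inducing an automorphism of the covered module
restricts to a surjection on the syzygy. -/
theorem IsProjCover.surjective_of_isUnit {M P : Mdl S} {p : P.carrier →ₗ[S] M.carrier}
    (hp : IsProjCover p) {e : Module.End S (LinearMap.ker p)} {b : Module.End S P.carrier}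
    {a : Module.End S M.carrier} (hbe : ∀ n : LinearMap.ker p, b n = e n) (hab : ∀ x, a (p x) = p (b x))
    (ha : IsUnit a) : Function.Surjective e := by
  obtain ⟨hainj, hasurj⟩ := (Module.End.isUnit_iff a).1 ha
  have hb : Function.Surjective b := by
    refine LinearMap.range_eq_top.1 (hp.2.2 _ (eq_top_iff.2 fun x _ => ?_))
    obtain ⟨z, hz⟩ := hasurj (p x)
    obtain ⟨y, rfl⟩ := hp.2.1 z
    exact Submodule.mem_sup.2 ⟨b y, ⟨y, rfl⟩, x - b y, by simp [← hab, hz], by simp⟩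
  rintro ⟨n, hn⟩
  obtain ⟨x, rfl⟩ := hb n
  have hx : p x = 0 := hainj (by rw [hab, map_zero]; exact hn)
  exact ⟨⟨x, hx⟩, Subtype.ext (hbe ⟨x, hx⟩).symm⟩

/-- Syzygies of Gorenstein projective modules with local endomorphism ring have only trivial
idempotent endomorphisms. -/
theorem IsGP.eq_zero_or_eq_one_of_isIdempotentElem {M P : Mdl S} (hM : IsGP M)
    (hloc : ∀ a : Module.End S M.carrier, IsUnit a ∨ IsUnit (1 - a))
    {p : P.carrier →ₗ[S] M.carrier} (hp : IsProjCover p) {e : Module.End S (LinearMap.ker p)}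
    (he : IsIdempotentElem e) : e = 0 ∨ e = 1 := by
  have key : ∀ f : Module.End S (LinearMap.ker p), IsIdempotentElem f →
      Function.Surjective f → f = 1 := by
    intro f hf hs
    ext x
    obtain ⟨y, rfl⟩ := hs x
    exact congrArg Subtype.val (LinearMap.congr_fun hf y)
  have := hp.1.1
  obtain ⟨b, hb⟩ := hM.exists_extension hp.2.1 ((LinearMap.ker p).subtype ∘ₗ e)
  have hb' : ∀ n : LinearMap.ker p, b n = e n := LinearMap.congr_fun hb
  obtain ⟨a, ha⟩ := LinearMap.exists_comp_eq_of_ker_le hp.2.1 (p ∘ₗ b) (fun x hx => by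
    have : b x = e ⟨x, hx⟩ := hb' ⟨x, hx⟩
    rw [LinearMap.mem_ker, LinearMap.comp_apply, this]
    exact (e ⟨x, hx⟩).2)
  have ha' : ∀ x, a (p x) = p (b x) := LinearMap.congr_fun ha
  rcases hloc a with h | h
  · exact .inr (key e he (hp.surjective_of_isUnit hb' ha' h))
  · have := key (1 - e) he.one_sub (hp.surjective_of_isUnit (b := 1 - b) (a := 1 - a)
      (fun n => by simp [hb']) (fun x => by simp [ha']) h)
    exact .inl (by simpa using this)

end Syzygies

/-- Minimal first syzygies preserve finitely generated indecomposable non-projective Gorenstein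
projective modules. -/
theorem IsSyz1.indecMod_and_not_projective_and_isGP (R : Type) [CommRing R] [IsNoetherianRing R]
    [IsLocalRing R] [IsAdicComplete (IsLocalRing.maximalIdeal R) R]
    {S : Type} [Ring S] [Algebra R S] [Module.Finite R S] {A N : Mdl S} (h : IsSyz1 A N)
    (hfin : Module.Finite S A.carrier) (hInd : IndecMod A)
    (hNonProj : ¬ Module.Projective S A.carrier) (hGP : IsGP A) :
    Module.Finite S N.carrier ∧ IndecMod N ∧ ¬ Module.Projective S N.carrier ∧ IsGP N := by
  have hN := hGP.of_isSyz1 h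
  obtain ⟨P, p, hp, ⟨e⟩⟩ := h
  have : IsNoetherianRing S := IsNoetherianRing.of_finite R S
  have := hp.1.2
  have hproj : ¬ Module.Projective S (LinearMap.ker p) := fun hker =>
    hNonProj (hGP.projective_of_ker hp.1.1 hp.2.1 hker)
  have : Nontrivial (Mdl.of S (LinearMap.ker p)).carrier := by
    by_contra hnt
    have : Subsingleton (LinearMap.ker p) := not_nontrivial_iff_subsingleton.1 hnt
    exact hproj inferInstance
  refine ⟨Module.Finite.equiv e.symm, IndecMod.congr (M := Mdl.of S (LinearMap.ker p)) e.symm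
    (.of_forall_isIdempotentElem fun f hf => ?_), fun h => hproj (.of_equiv e), hN⟩
  exact hGP.eq_zero_or_eq_one_of_isIdempotentElem (hInd.isUnit_or_isUnit_one_sub R) hp hf

theorem statement1 (R : Type) [CommRing R] [IsNoetherianRing R] [IsLocalRing R]
    [IsAdicComplete (IsLocalRing.maximalIdeal R) R]
    (Λ : Type) [Ring Λ] [Algebra R Λ] [Module.Finite R Λ]
    (A : Mdl Λ)
    (hfin : Module.Finite Λ A.carrier)
    (hInd : IndecMod A) (hNonProj : ¬ Module.Projective Λ A.carrier) (hGP : IsGP A) :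
    ∀ (i : ℕ) (N : Mdl Λ), IsSyz i A N →
      IndecMod N ∧ ¬ Module.Projective Λ N.carrier ∧ IsGP N := by
  rintro n N ⟨F, ⟨φ⟩, ⟨ψ⟩, hF⟩
  have key : ∀ i : Fin (n + 1), Module.Finite Λ (F i).carrier ∧ IndecMod (F i) ∧
      ¬ Module.Projective Λ (F i).carrier ∧ IsGP (F i) := by
    intro i
    induction i using Fin.induction with
    | zero => exact ⟨.equiv φ.symm, hInd.congr φ.symm, fun h => hNonProj (.of_equiv φ),
        hGP.congr φ.symm⟩
    | succ i ih =>
      exact (hF i).indecMod_and_not_projective_and_isGP R ih.1 ih.2.1 ih.2.2.1 ih.2.2.2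
  obtain ⟨-, h₁, h₂, h₃⟩ := key (Fin.last n)
  exact ⟨h₁.congr ψ, fun h => h₂ (.of_equiv ψ.symm), h₃.congr ψ⟩
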